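/- arXiv:2303.07744 — 3 statements merged into one kernel-verified Lean document; each statement's English description precedes it below -/
import Mathlib

section
/- Positive semidefiniteness of the one-dimensional C⁰ Wendland kernel: for every σ > 0, every n ∈ ℕ, all points x₁, …, xₙ ∈ ℝ and all coefficients c₁, …, cₙ ∈ ℝ, the double sum ∑ᵢ∑ⱼ cᵢ·cⱼ·(max(0, 1 − |xᵢ − xⱼ|/σ))² is nonnegative; that is, k₀ is a positive semidefinite (valid reproducing) kernel on ℝ. -/
open Finset

/-- The measure of the overlap of two unit intervals is the triangular function of the distance
between their left endpoints. -/
lemma volume_real_Icc_add_one_inter (a b : ℝ) :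
    MeasureTheory.volume.real (Set.Icc a (a + 1) ∩ Set.Icc b (b + 1)) = max 0 (1 - |a - b|) := by
  rw [Set.Icc_inter_Icc, Real.volume_real_Icc, max_comm]
  congr 1
  rcases le_total a b with h | h
  · rw [abs_of_nonpos (by linarith), sup_of_le_right h, inf_of_le_left (by linarith)]
    ring
  · rw [abs_of_nonneg (by linarith), sup_of_le_left h, inf_of_le_right (by linarith)]
    ring

/-- The triangular kernel of width one is positive semidefinite. -/
lemma posSemidef_triangular_kernel {ι : Type*} [Finite ι] (y : ι → ℝ) :
    (Matrix.of fun i j ↦ max 0 (1 - |y i - y j|)).PosSemidef := by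
  simpa only [volume_real_Icc_add_one_inter] using
    MeasureTheory.posSemidef_matrix_measure_inter (μ := MeasureTheory.volume)
      (s := fun i ↦ Set.Icc (y i) (y i + 1)) (fun _ ↦ measurableSet_Icc)
      (fun _ ↦ isCompact_Icc.measure_ne_top)

/-- Positive semidefiniteness of the one-dimensional `C⁰` Wendland kernel
`k₀(x, y) = (max(0, 1 − |x − y|/σ))²`: every quadratic form
`∑ᵢ∑ⱼ cᵢ cⱼ k₀(xᵢ, xⱼ)` is nonnegative, i.e. `k₀` is a valid positive semidefinite
reproducing kernel on `ℝ`. -/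
theorem wendland_kernel_posSemidef (σ : ℝ) (hσ : 0 < σ) (n : ℕ)
    (x : Fin n → ℝ) (c : Fin n → ℝ) :
    0 ≤ ∑ i : Fin n, ∑ j : Fin n,
      c i * c j * (max 0 (1 - |x i - x j| / σ)) ^ 2 := by
  have hT := posSemidef_triangular_kernel fun i ↦ x i / σ
  refine ((hT.hadamard hT).dotProduct_mulVec_nonneg c).trans_eq ?_
  simp only [dotProduct, Matrix.mulVec, Matrix.hadamard_apply, Matrix.of_apply, Pi.star_apply,
    star_trivial, Finset.mul_sum, ← sub_div, abs_div, abs_of_pos hσ]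
  refine Finset.sum_congr rfl fun i _ ↦ Finset.sum_congr rfl fun j _ ↦ ?_
  ring
end

section
/- Positive semidefiniteness of the multiplicative C⁰ Wendland kernel: for every σ > 0, d ≥ 1, every n ∈ ℕ, all points x₁, …, xₙ ∈ ℝ^d and all coefficients c₁, …, cₙ ∈ ℝ, the double sum ∑ᵢ∑ⱼ cᵢ·cⱼ·K_m(xᵢ, xⱼ) is nonnegative; that is, the multiplicative kernel constructed by multiplying one-dimensional C⁰ Wendland kernels is itself a valid positive semidefinite kernel on ℝ^d. -/
open Finset

/-- The triangle kernel is the length of the overlap of two translates of an interval. -/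
lemma posSemidef_triangle {ι : Type*} [Finite ι] {σ : ℝ} (hσ : 0 < σ) (t : ι → ℝ) :
    (Matrix.of fun i j ↦ max 0 (1 - |t i - t j| / σ)).PosSemidef := by
  have h := MeasureTheory.posSemidef_matrix_measure_inter (μ := MeasureTheory.volume)
    (s := fun i ↦ Set.Icc (t i / σ) (t i / σ + 1)) (fun _ ↦ measurableSet_Icc)
    (fun _ ↦ by simp)
  convert h using 1
  ext i j
  have habs : |t i - t j| / σ = |t i / σ - t j / σ| := by
    rw [← sub_div, abs_div, abs_of_pos hσ]
  simp only [Matrix.of_apply, Set.Icc_inter_Icc, Real.volume_real_Icc, habs]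
  rw [max_comm]
  congr 1
  rcases le_total (t i / σ) (t j / σ) with hle | hle
  · rw [abs_of_nonpos (by linarith), sup_eq_right.2 hle, inf_eq_left.2 (by linarith)]
    ring
  · rw [abs_of_nonneg (by linarith), sup_eq_left.2 hle, inf_eq_right.2 (by linarith)]
    ring

lemma posSemidef_of_one {ι : Type*} [Finite ι] :
    (Matrix.of fun _ _ : ι ↦ (1 : ℝ)).PosSemidef := by
  have heq : (Matrix.of fun _ _ : ι ↦ (1 : ℝ)) = Matrix.gram ℝ fun _ : ι ↦ (1 : ℝ) := by
    ext i j
    simp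
  rw [heq]
  exact Matrix.posSemidef_gram ℝ _

/-- An entrywise product of finitely many positive semidefinite matrices is positive
semidefinite. -/
lemma posSemidef_of_prod {ι κ : Type*} [Finite ι] (s : Finset κ) {A : κ → Matrix ι ι ℝ}
    (hA : ∀ k ∈ s, (A k).PosSemidef) :
    (Matrix.of fun i j ↦ ∏ k ∈ s, A k i j).PosSemidef := by
  classical
  induction s using Finset.induction_on with
  | empty => simpa using posSemidef_of_one
  | insert k s hk ih =>
    have heq : (Matrix.of fun i j ↦ ∏ l ∈ insert k s, A l i j) =
        (A k).hadamard (Matrix.of fun i j ↦ ∏ l ∈ s, A l i j) := by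
      ext i j
      simp [prod_insert hk]
    rw [heq]
    exact (hA k (mem_insert_self k s)).hadamard (ih fun l hl ↦ hA l (mem_insert_of_mem hl))

/-- Positive semidefiniteness of the multiplicative `C⁰` Wendland kernel
`K_m(x, y) = ∏ᵢ (max(0, 1 − |xⁱ − yⁱ|/σ))²` on `ℝ^d`: every quadratic form
`∑ᵢ∑ⱼ cᵢ cⱼ K_m(xᵢ, xⱼ)` is nonnegative, i.e. the product of one-dimensional
`C⁰` Wendland kernels is a valid positive semidefinite kernel. -/
theorem multiplicative_wendland_posSemidef (σ : ℝ) (hσ : 0 < σ)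
    (d : ℕ) (hd : 1 ≤ d) (n : ℕ) (x : Fin n → (Fin d → ℝ)) (c : Fin n → ℝ) :
    0 ≤ ∑ i : Fin n, ∑ j : Fin n,
      c i * c j * ∏ k : Fin d, (max 0 (1 - |x i k - x j k| / σ)) ^ 2 := by
  have hk (k : Fin d) :
      (Matrix.of fun i j ↦ (max 0 (1 - |x i k - x j k| / σ)) ^ 2).PosSemidef := by
    have h := posSemidef_triangle hσ fun i ↦ x i k
    simp only [sq]
    exact h.hadamard h
  have h := (posSemidef_of_prod univ fun k _ ↦ hk k).dotProduct_mulVec_nonneg c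
  refine h.trans_eq ?_
  simp only [dotProduct, Matrix.mulVec, mul_sum, Matrix.of_apply, star_trivial]
  exact sum_congr rfl fun i _ ↦ sum_congr rfl fun j _ ↦ by ring
end

section
/- Jump discontinuity of the derivative of the two-dimensional multiplicative C⁰ Wendland kernel: let σ > 0, y = (y₁, y₂) ∈ ℝ² and x₂ ∈ ℝ with |x₂ − y₂| < σ. Then the function g(x₁) := K_m((x₁, x₂), y) has right derivative −(2/σ)·(1 − |x₂ − y₂|/σ)² at x₁ = y₁ and left derivative (2/σ)·(1 − |x₂ − y₂|/σ)² at x₁ = y₁; since (1 − |x₂ − y₂|/σ)² > 0, these one-sided derivatives differ and g is not differentiable at x₁ = y₁, so the derivative kernel has a discontinuity plane along x₁ = y₁. -/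
/-- On a set where `|x - y|` is linear with slope `ε`, the one-dimensional `C⁰` Wendland kernel
has derivative `-(2 * ε / σ)` at its centre. -/
theorem hasDerivWithinAt_wendland_of_abs_eq {σ y ε : ℝ} {s : Set ℝ} (hσ : 0 < σ) (hy : y ∈ s)
    (hs : ∀ x ∈ s, |x - y| = ε * (x - y)) :
    HasDerivWithinAt (fun x : ℝ => (max 0 (1 - |x - y| / σ)) ^ 2) (-(2 * ε / σ)) s y := by
  have hpoly : HasDerivWithinAt (fun x : ℝ => (1 - ε * (x - y) / σ) ^ 2) (-(2 * ε / σ)) s y := by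
    have h := ((((((hasDerivAt_id y).sub_const y).const_mul ε).div_const σ).const_sub 1).pow 2)
    refine h.hasDerivWithinAt.congr_deriv ?_
    simp
    ring
  have heq : ∀ x ∈ s, |x - y| < σ →
      (max 0 (1 - |x - y| / σ)) ^ 2 = (1 - ε * (x - y) / σ) ^ 2 := by
    intro x hx hlt
    rw [max_eq_right (sub_nonneg.2 ((div_le_one hσ).2 hlt.le)), hs x hx]
  refine hpoly.congr_of_eventuallyEq ?_ (heq y hy (by simpa using hσ))
  filter_upwards [self_mem_nhdsWithin,
    mem_nhdsWithin_of_mem_nhds (Metric.ball_mem_nhds y hσ)] with x hx hball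
  exact heq x hx (by simpa [Real.dist_eq] using hball)

/-- Jump discontinuity of the derivative of the two-dimensional multiplicative `C⁰`
Wendland kernel: for `|x₂ − y₂| < σ`, the section
`g(x₁) = K_m((x₁, x₂), (y₁, y₂)) = (max(0, 1 − |x₁ − y₁|/σ))² · (max(0, 1 − |x₂ − y₂|/σ))²`
has right derivative `−(2/σ)·(1 − |x₂ − y₂|/σ)²` and left derivative
`(2/σ)·(1 − |x₂ − y₂|/σ)²` at `x₁ = y₁`; since `(1 − |x₂ − y₂|/σ)² > 0`, these
one-sided derivatives differ and `g` is not differentiable at `x₁ = y₁`. -/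
theorem multiplicative_wendland_derivative_jump_2d (σ : ℝ) (hσ : 0 < σ)
    (y₁ y₂ x₂ : ℝ) (h : |x₂ - y₂| < σ) :
    HasDerivWithinAt
      (fun x₁ : ℝ => (max 0 (1 - |x₁ - y₁| / σ)) ^ 2 * (max 0 (1 - |x₂ - y₂| / σ)) ^ 2)
      (-(2 / σ) * (1 - |x₂ - y₂| / σ) ^ 2) (Set.Ici y₁) y₁ ∧
    HasDerivWithinAt
      (fun x₁ : ℝ => (max 0 (1 - |x₁ - y₁| / σ)) ^ 2 * (max 0 (1 - |x₂ - y₂| / σ)) ^ 2)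
      ((2 / σ) * (1 - |x₂ - y₂| / σ) ^ 2) (Set.Iic y₁) y₁ ∧
    0 < (1 - |x₂ - y₂| / σ) ^ 2 ∧
    ¬ DifferentiableAt ℝ
      (fun x₁ : ℝ => (max 0 (1 - |x₁ - y₁| / σ)) ^ 2 * (max 0 (1 - |x₂ - y₂| / σ)) ^ 2)
      y₁ := by
  have hpos : 0 < 1 - |x₂ - y₂| / σ := sub_pos.2 ((div_lt_one hσ).2 h)
  have hsq : 0 < (1 - |x₂ - y₂| / σ) ^ 2 := pow_pos hpos 2
  rw [max_eq_right hpos.le]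
  have hright := (hasDerivWithinAt_wendland_of_abs_eq (y := y₁) (ε := 1) hσ Set.self_mem_Ici
    fun x hx => by rw [one_mul, abs_of_nonneg (sub_nonneg.2 hx)]).mul_const
      ((1 - |x₂ - y₂| / σ) ^ 2)
  have hleft := (hasDerivWithinAt_wendland_of_abs_eq (y := y₁) (ε := -1) hσ Set.self_mem_Iic
    fun x hx => by rw [neg_one_mul, abs_of_nonpos (sub_nonpos.2 hx)]).mul_const
      ((1 - |x₂ - y₂| / σ) ^ 2)
  refine ⟨hright.congr_deriv (by ring), hleft.congr_deriv (by ring), hsq, fun hdiff => ?_⟩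
  have hd := hdiff.hasDerivAt
  have hjump := ((uniqueDiffWithinAt_Ici y₁).eq_deriv _ hright hd.hasDerivWithinAt).trans
    ((uniqueDiffWithinAt_Iic y₁).eq_deriv _ hleft hd.hasDerivWithinAt).symm
  have hslope := mul_right_cancel₀ hsq.ne' hjump
  have : 0 < 2 / σ := by positivity
  rw [mul_one, mul_neg_one, neg_div] at hslope
  linarith
end
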